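/- Let J ⊆ I and v, w ∈ W with v ≤^J w. Let c be a Bruhat-minimal element of the (nonempty) set {u ∈ W_J : v^J u ≤ w^J and w_J ≤ u^{-1} v_J}. Then ℓ(c w_J) = ℓ(w_J) − ℓ(c) and ℓ(c^{-1} v_J) = ℓ(c) + ℓ(v_J). -/

import Mathlib

/-!
Common definitions: Bruhat order, standard parabolic subgroups, minimal coset
representatives, the J-Bruhat (twisted) order and J-length, chains and
EL-labeling machinery, for a Coxeter system `cs : CoxeterSystem M W`.
-/

open scoped Classical

namespace TwistedTP

/-- A chain (list) realizing consecutive `r`-steps starting at `a` and ending at `b`. -/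
def IsChainFrom {α : Type*} (r : α → α → Prop) (c : List α) (a b : α) : Prop :=
  c.head? = some a ∧ c.getLast? = some b ∧ c.Chain' r

/-- The word of labels attached to the consecutive pairs of a list.
For a list `z₀ :: z₁ :: ⋯` (written from top to bottom in a descending chain),
the entries are `lab z₁ z₀, lab z₂ z₁, …`, i.e. `lab` is applied to each
covering pair `(lower, upper)`. -/
def labelWord {α Λ : Type*} (lab : α → α → Λ) : List α → List Λ
  | a :: b :: rest => lab b a :: labelWord lab (b :: rest)
  | _ => []

variable {B : Type*} {W : Type*} [Group W] {M : CoxeterMatrix B}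
variable (cs : CoxeterSystem M W)

/-- The (strong) Bruhat order on `W`: `v ≤ w` iff some reduced word for `w`
has a sublist whose product is `v`. -/
def bruhatLE (v w : W) : Prop :=
  ∃ ω : List B, cs.IsReduced ω ∧ cs.wordProd ω = w ∧
    ∃ ω' : List B, ω'.Sublist ω ∧ cs.wordProd ω' = v

def bruhatLT (v w : W) : Prop := bruhatLE cs v w ∧ v ≠ w

def bruhatCovBy (v w : W) : Prop :=
  bruhatLT cs v w ∧ ¬ ∃ z, bruhatLT cs v z ∧ bruhatLT cs z w

/-- The standard parabolic subgroup `W_J`. -/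
def parabolic (J : Set B) : Subgroup W := Subgroup.closure (cs.simple '' J)

lemma exists_minRep (J : Set B) (w : W) :
    ∃ u : W, u⁻¹ * w ∈ parabolic cs J ∧
      ∀ x : W, x⁻¹ * w ∈ parabolic cs J → cs.length u ≤ cs.length x := by
  have hne : (cs.length '' {x : W | x⁻¹ * w ∈ parabolic cs J}).Nonempty :=
    ⟨cs.length w, w, by simpa using (parabolic cs J).one_mem, rfl⟩
  obtain ⟨n, hn, hmin⟩ := Nat.lt_wfRel.wf.has_min _ hne
  obtain ⟨u, hu, rfl⟩ := hn
  refine ⟨u, hu, fun x hx => ?_⟩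
  by_contra h
  exact hmin _ ⟨x, hx, rfl⟩ (Nat.lt_of_not_le h)

/-- The minimal-length representative `w^J` of the coset `w W_J`. -/
noncomputable def minRep (J : Set B) (w : W) : W := (exists_minRep cs J w).choose

/-- The parabolic part `w_J = (w^J)⁻¹ w ∈ W_J` of `w`. -/
noncomputable def parPart (J : Set B) (w : W) : W := (minRep cs J w)⁻¹ * w

/-- The J-Bruhat (twisted) order `≤^J` on `W`:
`v ≤^J w` iff there is `u ∈ W_J` with `v^J u ≤ w^J` and `w_J ≤ u⁻¹ v_J`. -/
def twistedLE (J : Set B) (v w : W) : Prop :=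
  ∃ u ∈ parabolic cs J,
    bruhatLE cs (minRep cs J v * u) (minRep cs J w) ∧
    bruhatLE cs (parPart cs J w) (u⁻¹ * parPart cs J v)

def twistedLT (J : Set B) (v w : W) : Prop := twistedLE cs J v w ∧ v ≠ w

def twistedCovBy (J : Set B) (v w : W) : Prop :=
  twistedLT cs J v w ∧ ¬ ∃ z, twistedLT cs J v z ∧ twistedLT cs J z w

/-- The J-length `ℓ^J(w) = ℓ(w^J) - ℓ(w_J)` (an integer). -/
noncomputable def twistedLength (J : Set B) (w : W) : ℤ :=
  (cs.length (minRep cs J w) : ℤ) - (cs.length (parPart cs J w) : ℤ)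



section StrongExchange

/-- The involution of `W × ZMod 2` attached to a simple reflection `s`: it conjugates the first
component by `s` and changes the second one exactly at `s`. -/
noncomputable def signedConj (i : B) : Equiv.Perm (W × ZMod 2) :=
  Function.Involutive.toPerm
    (fun p => (cs.simple i * p.1 * cs.simple i, p.2 + if p.1 = cs.simple i then 1 else 0)) <| by
    rintro ⟨t, e⟩
    have h : cs.simple i * t * cs.simple i = cs.simple i ↔ t = cs.simple i := by
      constructor
      · intro h
        have := congrArg (fun x => cs.simple i * x * cs.simple i) h
        simpa [mul_assoc] using this
      · rintro rfl
        simp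
    have h2 : (1 : ZMod 2) + 1 = 0 := by decide
    simp only [h]
    split_ifs <;> simp [mul_assoc, add_assoc, h2]

lemma signedConj_apply (i : B) (t : W) (e : ZMod 2) :
    signedConj cs i (t, e) =
      (cs.simple i * t * cs.simple i, e + if t = cs.simple i then 1 else 0) := rfl

lemma prod_map_signedConj_apply (ω : List B) (t : W) (e : ZMod 2) :
    (ω.map (signedConj cs)).prod (t, e) =
      (cs.wordProd ω * t * (cs.wordProd ω)⁻¹, e + ((cs.rightInvSeq ω).count t : ZMod 2)) := by
  induction ω with
  | nil => simp
  | cons i ω ih =>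
    have h : cs.wordProd ω * t * (cs.wordProd ω)⁻¹ = cs.simple i ↔
        (cs.wordProd ω)⁻¹ * cs.simple i * cs.wordProd ω = t := by
      rw [mul_inv_eq_iff_eq_mul, mul_assoc, inv_mul_eq_iff_eq_mul, eq_comm]
    rw [List.map_cons, List.prod_cons, Equiv.Perm.mul_apply, ih, signedConj_apply]
    simp only [h, CoxeterSystem.rightInvSeq, List.count_cons, beq_iff_eq, Nat.cast_add,
      Nat.cast_ite, Nat.cast_one, Nat.cast_zero, add_assoc]
    simp only [cs.wordProd_cons, mul_inv_rev, cs.inv_simple, mul_assoc]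

lemma reverse_alternatingWord (i j : B) (p : ℕ) :
    (CoxeterSystem.alternatingWord i j (2 * p)).reverse =
      CoxeterSystem.alternatingWord j i (2 * p) := by
  apply List.ext_getElem (by simp)
  intro k h₁ h₂
  have hk : k < 2 * p := by simpa using h₂
  rw [List.getElem_reverse, CoxeterSystem.getElem_alternatingWord _ _ _ _ (by simp; omega),
    CoxeterSystem.getElem_alternatingWord _ _ _ _ hk]
  simp only [CoxeterSystem.length_alternatingWord]
  grind

lemma even_count_rightInvSeq_alternatingWord (i j : B) (t : W) :
    Even ((cs.rightInvSeq (CoxeterSystem.alternatingWord i j (2 * M i j))).count t) := by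
  rw [← reverse_alternatingWord, cs.rightInvSeq_reverse, List.count_reverse]
  set m := M i j with hm
  set L := cs.leftInvSeq (CoxeterSystem.alternatingWord j i (2 * m)) with hL
  have hlen : L.length = 2 * m := by simp [hL]
  have hhalf : L.drop m = L.take m := by
    apply List.ext_getElem (by simp [hlen]; omega)
    intro k h₁ h₂
    have hk : k < m := by simp [hlen] at h₂; omega
    rw [List.getElem_drop, List.getElem_take]
    simp only [hL]
    rw [cs.getElem_leftInvSeq_alternatingWord _ _ _ _ (by omega),
      cs.getElem_leftInvSeq_alternatingWord _ _ _ _ (by omega),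
      cs.prod_alternatingWord_eq_mul_pow, cs.prod_alternatingWord_eq_mul_pow]
    have e₁ : (2 * (m + k) + 1) / 2 = m + k := by omega
    have e₂ : (2 * k + 1) / 2 = k := by omega
    have e₃ : ¬ Even (2 * (m + k) + 1) := by simp [parity_simps]
    have e₄ : ¬ Even (2 * k + 1) := by simp [parity_simps]
    rw [e₁, e₂, if_neg e₃, if_neg e₄, pow_add, hm, cs.simple_mul_simple_pow, one_mul]
  rw [← List.take_append_drop m L, List.count_append, hhalf]
  exact ⟨_, rfl⟩

lemma prod_map_alternatingWord {G : Type*} [Monoid G] (f : B → G) (i j : B) (p : ℕ) :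
    ((CoxeterSystem.alternatingWord i j (2 * p)).map f).prod = (f i * f j) ^ p := by
  induction p with
  | zero => simp [CoxeterSystem.alternatingWord]
  | succ p ih =>
    rw [show 2 * (p + 1) = 2 * p + 1 + 1 by ring, CoxeterSystem.alternatingWord_succ,
      CoxeterSystem.alternatingWord_succ, pow_succ, ← ih]
    simp

lemma isLiftable_signedConj : M.IsLiftable (signedConj cs) := by
  intro i j
  rw [← prod_map_alternatingWord]
  ext1 ⟨t, e⟩
  have h : ((cs.rightInvSeq (CoxeterSystem.alternatingWord i j (2 * M i j))).count t : ZMod 2)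
      = 0 := (ZMod.natCast_eq_zero_iff_even).2 (even_count_rightInvSeq_alternatingWord cs i j t)
  rw [prod_map_signedConj_apply, h, cs.prod_alternatingWord_eq_mul_pow]
  simp

/-- The action of `W` on `W × ZMod 2` extending `signedConj`. -/
noncomputable def signedConjHom : W →* Equiv.Perm (W × ZMod 2) :=
  cs.lift ⟨signedConj cs, isLiftable_signedConj cs⟩

lemma signedConjHom_wordProd (ω : List B) (t : W) (e : ZMod 2) :
    signedConjHom cs (cs.wordProd ω) (t, e) =
      (cs.wordProd ω * t * (cs.wordProd ω)⁻¹, e + ((cs.rightInvSeq ω).count t : ZMod 2)) := by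
  rw [← prod_map_signedConj_apply, CoxeterSystem.wordProd, map_list_prod, List.map_map]
  have h : signedConjHom cs ∘ cs.simple = signedConj cs :=
    funext fun i => cs.lift_apply_simple _ i
  rw [h]

lemma signedConjHom_apply_add (w t : W) (e d : ZMod 2) :
    signedConjHom cs w (t, e + d) =
      ((signedConjHom cs w (t, e)).1, (signedConjHom cs w (t, e)).2 + d) := by
  obtain ⟨ω, rfl⟩ := cs.wordProd_surjective w
  simp [signedConjHom_wordProd, add_right_comm]

lemma signedConjHom_reflection {t : W} (ht : cs.IsReflection t) (e : ZMod 2) :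
    signedConjHom cs t (t, e) = (t, e + 1) := by
  obtain ⟨x, i, rfl⟩ := ht
  set t := x * cs.simple i * x⁻¹ with ht
  obtain ⟨a, ha⟩ : ∃ a, signedConjHom cs x⁻¹ (t, e) = (cs.simple i, a) := by
    obtain ⟨ω, hω⟩ := cs.wordProd_surjective x⁻¹
    refine ⟨e + ((cs.rightInvSeq ω).count t : ZMod 2), ?_⟩
    rw [← hω, signedConjHom_wordProd, hω]
    simp [ht, mul_assoc]
  have hs : signedConjHom cs (cs.simple i) (cs.simple i, a) = (cs.simple i, a + 1) := by
    rw [signedConjHom, cs.lift_apply_simple, signedConj_apply]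
    simp
  have hx : signedConjHom cs x (cs.simple i, a) = (t, e) := by
    rw [← ha, ← Equiv.Perm.mul_apply, ← map_mul]
    simp
  conv_lhs => rw [ht, map_mul, map_mul, ← ht]
  rw [Equiv.Perm.mul_apply, Equiv.Perm.mul_apply, ha, hs, signedConjHom_apply_add, hx]

lemma mem_rightInvSeq_of_length_lt {t : W} (ht : cs.IsReflection t) (ω : List B)
    (h : cs.length (cs.wordProd ω * t) < cs.length (cs.wordProd ω)) :
    t ∈ cs.rightInvSeq ω := by
  by_contra hmem
  obtain ⟨ω', hred, hω'⟩ := cs.exists_isReduced (cs.wordProd ω * t)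
  have hcount : ((cs.rightInvSeq ω').count t : ZMod 2) = 1 := by
    have := congrArg Prod.snd (signedConjHom_wordProd cs ω' t 0)
    rw [← hω', map_mul, Equiv.Perm.mul_apply, signedConjHom_reflection cs ht,
      signedConjHom_wordProd, List.count_eq_zero_of_not_mem hmem] at this
    simpa using this.symm
  have hmem' : t ∈ cs.rightInvSeq ω' := by
    by_contra h'
    simp [List.count_eq_zero_of_not_mem h'] at hcount
  have := (cs.isRightInversion_of_mem_rightInvSeq hred hmem').2
  rw [← hω', mul_assoc, ht.mul_self, mul_one] at this
  omega

/-- The strong exchange property, on the right. -/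
lemma exists_eraseIdx_of_length_mul_lt {t : W} (ht : cs.IsReflection t) (ω : List B)
    (h : cs.length (cs.wordProd ω * t) < cs.length (cs.wordProd ω)) :
    ∃ j < ω.length, cs.wordProd ω * t = cs.wordProd (ω.eraseIdx j) := by
  obtain ⟨j, hj, rfl⟩ := List.mem_iff_getElem.mp (mem_rightInvSeq_of_length_lt cs ht ω h)
  refine ⟨j, by simpa using hj, ?_⟩
  rw [← cs.wordProd_mul_getD_rightInvSeq, List.getD_eq_getElem _ 1 hj]

/-- The strong exchange property, on the left. -/
lemma exists_eraseIdx_of_mul_length_lt {t : W} (ht : cs.IsReflection t) (ω : List B)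
    (h : cs.length (t * cs.wordProd ω) < cs.length (cs.wordProd ω)) :
    ∃ j < ω.length, t * cs.wordProd ω = cs.wordProd (ω.eraseIdx j) := by
  have h' := ht.conj (cs.wordProd ω)⁻¹
  have e : cs.wordProd ω * ((cs.wordProd ω)⁻¹ * t * (cs.wordProd ω)⁻¹⁻¹) =
      t * cs.wordProd ω := by simp [mul_assoc]
  rw [← e] at h ⊢
  exact exists_eraseIdx_of_length_mul_lt cs h' ω h

end StrongExchange

section Bruhat

/-- One step up in the Bruhat order: left multiplication by a reflection that increases
the length. -/
def reflStep (u v : W) : Prop :=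
  ∃ t, cs.IsReflection t ∧ v = t * u ∧ cs.length u < cs.length v

lemma exists_sublist_of_reflTransGen {u w : W} (h : Relation.ReflTransGen (reflStep cs) u w)
    {ω : List B} (hω : cs.wordProd ω = w) :
    ∃ ω' : List B, ω'.Sublist ω ∧ cs.wordProd ω' = u := by
  induction h using Relation.ReflTransGen.head_induction_on with
  | refl => exact ⟨ω, .refl _, hω⟩
  | head hstep _ ih =>
    obtain ⟨ω', hsub, hprod⟩ := ih
    obtain ⟨t, ht, hv, hlt⟩ := hstep
    have hu := congrArg (t * ·) hv
    simp only [← mul_assoc, ht.mul_self, one_mul] at hu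
    rw [← hu, ← hprod] at hlt
    obtain ⟨j, -, hj⟩ := exists_eraseIdx_of_mul_length_lt cs ht ω' hlt
    exact ⟨_, (List.eraseIdx_sublist _ _).trans hsub, by rw [← hj, hprod, hu]⟩

lemma reflStep_simple {w : W} {i : B} (h : cs.length w < cs.length (cs.simple i * w)) :
    reflStep cs w (cs.simple i * w) :=
  ⟨_, cs.isReflection_simple i, rfl, h⟩

lemma isReduced_of_cons {i : B} {ω : List B} (h : cs.IsReduced (i :: ω)) : cs.IsReduced ω := by
  simpa using h.drop 1

lemma length_lt_of_isReduced_cons {i : B} {ω : List B} (h : cs.IsReduced (i :: ω)) :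
    cs.length (cs.wordProd ω) < cs.length (cs.simple i * cs.wordProd ω) := by
  rw [← cs.wordProd_cons, h.eq, (isReduced_of_cons cs h).eq]
  simp

lemma isReduced_cons {i : B} {ω : List B} (h : cs.IsReduced ω)
    (hlt : cs.length (cs.wordProd ω) < cs.length (cs.simple i * cs.wordProd ω)) :
    cs.IsReduced (i :: ω) := by
  have := cs.length_wordProd_le (i :: ω)
  rw [cs.wordProd_cons] at this
  rw [h.eq] at hlt
  rw [CoxeterSystem.IsReduced, cs.wordProd_cons]
  simp only [List.length_cons] at *
  omega

lemma reflStep_simple_mul {u v : W} (h : reflStep cs u v) (i : B) :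
    cs.simple i * u = v ∨ reflStep cs (cs.simple i * u) (cs.simple i * v) := by
  obtain ⟨t, ht, rfl, hlt⟩ := h
  by_cases hts : t = cs.simple i
  · exact .inl (by rw [hts])
  refine .inr ⟨cs.simple i * t * cs.simple i, by simpa using ht.conj (cs.simple i),
    by simp [mul_assoc], ?_⟩
  have ht' : cs.IsReflection (cs.simple i * t * cs.simple i) := by simpa using ht.conj (cs.simple i)
  have hne := ht'.length_mul_right_ne (cs.simple i * u)
  have e : cs.simple i * t * cs.simple i * (cs.simple i * u) = cs.simple i * (t * u) := by
    simp [mul_assoc]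
  rw [e] at hne
  by_contra hle
  have hlt' : cs.length (cs.simple i * (t * u)) < cs.length (cs.simple i * u) := by omega
  have h₁ := cs.length_simple_mul u i
  have h₂ := cs.length_simple_mul (t * u) i
  have hup : cs.length u < cs.length (cs.simple i * u) := by omega
  obtain ⟨ω, hred, rfl⟩ := cs.exists_isReduced u
  rw [← e] at hlt'
  rw [← cs.wordProd_cons] at hlt'
  obtain ⟨j, hj, hjeq⟩ := exists_eraseIdx_of_mul_length_lt cs ht' (i :: ω) hlt'
  rw [cs.wordProd_cons, e] at hjeq
  cases j with
  | zero =>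
    apply hts
    simp only [List.eraseIdx_zero, List.tail_cons, ← mul_assoc, mul_eq_right] at hjeq
    simpa using (eq_inv_of_mul_eq_one_right hjeq)
  | succ j =>
    rw [List.eraseIdx_cons_succ, cs.wordProd_cons, mul_right_inj] at hjeq
    have := cs.length_wordProd_le (ω.eraseIdx j)
    have hl := List.length_eraseIdx_le ω j
    rw [← hjeq] at this
    rw [hred.eq] at hlt
    omega

lemma reflTransGen_simple_mul {u v : W} (h : Relation.ReflTransGen (reflStep cs) u v) (i : B) :
    Relation.ReflTransGen (reflStep cs) (cs.simple i * u) v ∨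
      Relation.ReflTransGen (reflStep cs) (cs.simple i * u) (cs.simple i * v) := by
  induction h using Relation.ReflTransGen.head_induction_on with
  | refl => exact .inr .refl
  | head hstep hrest ih =>
    rcases reflStep_simple_mul cs hstep i with rfl | hs
    · exact .inl hrest
    · exact ih.imp (.head hs) (.head hs)

lemma reflTransGen_of_sublist {ω ω' : List B} (hω : cs.IsReduced ω) (h : ω'.Sublist ω) :
    Relation.ReflTransGen (reflStep cs) (cs.wordProd ω') (cs.wordProd ω) := by
  induction h with
  | slnil => exact .refl
  | cons i h ih =>
    rw [cs.wordProd_cons]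
    exact (ih (isReduced_of_cons cs hω)).tail
      (reflStep_simple cs (length_lt_of_isReduced_cons cs hω))
  | cons_cons i h ih =>
    rw [cs.wordProd_cons, cs.wordProd_cons]
    rcases reflTransGen_simple_mul cs (ih (isReduced_of_cons cs hω)) i with h' | h'
    · exact h'.tail (reflStep_simple cs (length_lt_of_isReduced_cons cs hω))
    · exact h'

lemma bruhatLE_iff_reflTransGen {u w : W} :
    bruhatLE cs u w ↔ Relation.ReflTransGen (reflStep cs) u w := by
  constructor
  · rintro ⟨ω, hω, rfl, ω', hsub, rfl⟩
    exact reflTransGen_of_sublist cs hω hsub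
  · intro h
    obtain ⟨ω, hω, rfl⟩ := cs.exists_isReduced w
    exact ⟨ω, hω, rfl, exists_sublist_of_reflTransGen cs h rfl⟩

/-- Every word for `w`, reduced or not, contains a subword for each `u ≤ w`. -/
lemma bruhatLE.exists_sublist {u w : W} (h : bruhatLE cs u w) {ω : List B}
    (hω : cs.wordProd ω = w) : ∃ ω' : List B, ω'.Sublist ω ∧ cs.wordProd ω' = u :=
  exists_sublist_of_reflTransGen cs ((bruhatLE_iff_reflTransGen cs).1 h) hω

lemma bruhatLE_refl (w : W) : bruhatLE cs w w :=
  (bruhatLE_iff_reflTransGen cs).2 .refl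

lemma bruhatLE.trans {u v w : W} (h₁ : bruhatLE cs u v) (h₂ : bruhatLE cs v w) :
    bruhatLE cs u w := by
  rw [bruhatLE_iff_reflTransGen] at *
  exact Relation.ReflTransGen.trans h₁ h₂

lemma bruhatLE.antisymm {u w : W} (h₁ : bruhatLE cs u w) (h₂ : bruhatLE cs w u) : u = w := by
  have hlen : ∀ {a b : W}, bruhatLE cs a b → cs.length a ≤ cs.length b := by
    rintro _ _ ⟨ω, hω, rfl, ω', hsub, rfl⟩
    exact (cs.length_wordProd_le _).trans (hsub.length_le.trans hω.ge)
  have hle := hlen h₂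
  obtain ⟨ω, hω, rfl, ω', hsub, rfl⟩ := h₁
  rw [hω.eq] at hle
  rw [hsub.eq_of_length_le (hle.trans (cs.length_wordProd_le _))]

lemma bruhatLE_simple_mul {w : W} {i : B} (h : cs.length w < cs.length (cs.simple i * w)) :
    bruhatLE cs w (cs.simple i * w) :=
  (bruhatLE_iff_reflTransGen cs).2 (.single (reflStep_simple cs h))

lemma bruhatLE_mul_simple {w : W} {i : B} (h : cs.length w < cs.length (w * cs.simple i)) :
    bruhatLE cs w (w * cs.simple i) := by
  refine (bruhatLE_iff_reflTransGen cs).2 (.single ⟨w * cs.simple i * w⁻¹, ⟨w, i, rfl⟩, ?_, h⟩)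
  simp [mul_assoc]

lemma bruhatLE.mul_of_length_add {x u w : W} (h : bruhatLE cs u w)
    (hadd : cs.length (x * w) = cs.length x + cs.length w) :
    bruhatLE cs (x * u) (x * w) := by
  obtain ⟨ω, hω, rfl, ω', hsub, rfl⟩ := h
  obtain ⟨α, hα, rfl⟩ := cs.exists_isReduced x
  refine ⟨α ++ ω, ?_, cs.wordProd_append _ _, α ++ ω', hsub.append_left α,
    cs.wordProd_append _ _⟩
  rw [CoxeterSystem.IsReduced, cs.wordProd_append, hadd, hα.eq, hω.eq, List.length_append]

lemma bruhatLE.inv {u w : W} (h : bruhatLE cs u w) : bruhatLE cs u⁻¹ w⁻¹ := by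
  obtain ⟨ω, hω, rfl, ω', hsub, rfl⟩ := h
  exact ⟨ω.reverse, hω.reverse, by simp, ω'.reverse, hsub.reverse, by simp⟩

/-- If `u ≤ w`, then `s u` lies below the larger of `w` and `s w`. -/
lemma bruhatLE.simple_mul_le {u w : W} (h : bruhatLE cs u w) {i : B}
    (hi : cs.length (cs.simple i * w) < cs.length w) : bruhatLE cs (cs.simple i * u) w := by
  rw [bruhatLE_iff_reflTransGen] at *
  rcases reflTransGen_simple_mul cs h i with h' | h'
  · exact h'
  · have := reflStep_simple cs (w := cs.simple i * w) (i := i) (by simpa using hi)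
    rw [cs.simple_mul_simple_cancel_left] at this
    exact h'.tail this

lemma bruhatLE.simple_mul_le_simple_mul {u w : W} (h : bruhatLE cs u w) {i : B}
    (hi : cs.length w < cs.length (cs.simple i * w)) :
    bruhatLE cs (cs.simple i * u) (cs.simple i * w) :=
  bruhatLE.simple_mul_le cs (h.trans cs (bruhatLE_simple_mul cs hi)) (by simpa using hi)

/-- If `u ≤ w`, then the smaller of `u` and `s u` lies below `s w`. -/
lemma bruhatLE.le_simple_mul {u w : W} (h : bruhatLE cs u w) (i : B) :
    (cs.length (cs.simple i * u) < cs.length u → bruhatLE cs (cs.simple i * u) (cs.simple i * w)) ∧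
    (cs.length u < cs.length (cs.simple i * u) → bruhatLE cs u (cs.simple i * w)) := by
  obtain ⟨α, hα, hαw⟩ := cs.exists_isReduced (cs.simple i * w)
  have hword : cs.wordProd (i :: α) = w := by rw [cs.wordProd_cons, ← hαw]; simp
  obtain ⟨ω', hsub, rfl⟩ := h.exists_sublist cs hword
  have key : bruhatLE cs (cs.wordProd ω') (cs.simple i * w) ∨
      bruhatLE cs (cs.simple i * cs.wordProd ω') (cs.simple i * w) := by
    rcases List.sublist_cons_iff.1 hsub with h' | ⟨r, rfl, h'⟩
    · exact .inl ⟨α, hα, hαw.symm, ω', h', rfl⟩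
    · exact .inr ⟨α, hα, hαw.symm, r, h', by simp [cs.wordProd_cons]⟩
  refine ⟨fun hlt => ?_, fun hlt => ?_⟩
  · rcases key with h' | h'
    · refine bruhatLE.trans cs ?_ h'
      simpa using bruhatLE_simple_mul cs (w := cs.simple i * cs.wordProd ω') (i := i)
        (by simpa using hlt)
    · exact h'
  · rcases key with h' | h'
    · exact h'
    · exact (bruhatLE_simple_mul cs hlt).trans cs h'

end Bruhat

section Parabolic

lemma exists_word_of_mem_parabolic {J : Set B} {w : W} (h : w ∈ parabolic cs J) :
    ∃ ω : List B, (∀ i ∈ ω, i ∈ J) ∧ cs.wordProd ω = w := by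
  induction h using Subgroup.closure_induction with
  | mem x hx =>
    obtain ⟨i, hi, rfl⟩ := hx
    exact ⟨[i], by simpa using hi, by simp⟩
  | one => exact ⟨[], by simp, by simp⟩
  | mul x y _ _ hx hy =>
    obtain ⟨ω, hω, rfl⟩ := hx
    obtain ⟨ω', hω', rfl⟩ := hy
    refine ⟨ω ++ ω', fun i hi => ?_, cs.wordProd_append _ _⟩
    exact (List.mem_append.1 hi).elim (hω i) (hω' i)
  | inv x _ hx =>
    obtain ⟨ω, hω, rfl⟩ := hx
    exact ⟨ω.reverse, by simpa using hω, by simp⟩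

lemma wordProd_mem_parabolic {J : Set B} {ω : List B} (h : ∀ i ∈ ω, i ∈ J) :
    cs.wordProd ω ∈ parabolic cs J := by
  refine Subgroup.list_prod_mem _ fun x hx => ?_
  obtain ⟨i, hi, rfl⟩ := List.mem_map.1 hx
  exact Subgroup.subset_closure ⟨i, h i hi, rfl⟩

lemma mem_parabolic_of_bruhatLE {J : Set B} {u w : W} (h : bruhatLE cs u w)
    (hw : w ∈ parabolic cs J) : u ∈ parabolic cs J := by
  obtain ⟨ω, hω, hprod⟩ := exists_word_of_mem_parabolic cs hw
  obtain ⟨ω', hsub, rfl⟩ := h.exists_sublist cs hprod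
  exact wordProd_mem_parabolic cs fun i hi => hω i (hsub.subset hi)

lemma exists_isReduced_sublist (ω : List B) :
    ∃ ω' : List B, ω'.Sublist ω ∧ cs.IsReduced ω' ∧ cs.wordProd ω' = cs.wordProd ω := by
  induction ω with
  | nil => exact ⟨[], .refl _, by simp [CoxeterSystem.IsReduced], rfl⟩
  | cons i ω ih =>
    obtain ⟨ω', hsub, hred, hprod⟩ := ih
    rcases cs.length_simple_mul (cs.wordProd ω') i with hl | hl
    · exact ⟨i :: ω', hsub.cons_cons i, isReduced_cons cs hred (by omega),
        by rw [cs.wordProd_cons, cs.wordProd_cons, hprod]⟩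
    · obtain ⟨j, hj, hjeq⟩ := exists_eraseIdx_of_mul_length_lt cs (cs.isReflection_simple i) ω'
        (by omega)
      refine ⟨ω'.eraseIdx j, ((List.eraseIdx_sublist _ _).trans hsub).cons i, ?_,
        by rw [← hjeq, cs.wordProd_cons, hprod]⟩
      have := List.length_eraseIdx_add_one hj
      rw [hred.eq] at hl
      rw [CoxeterSystem.IsReduced, ← hjeq]
      omega

lemma inv_minRep_mul_mem (J : Set B) (w : W) : (minRep cs J w)⁻¹ * w ∈ parabolic cs J :=
  (exists_minRep cs J w).choose_spec.1

lemma length_minRep_le {J : Set B} {w d : W} (hd : d ∈ parabolic cs J) :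
    cs.length (minRep cs J w) ≤ cs.length (minRep cs J w * d) := by
  refine (exists_minRep cs J w).choose_spec.2 _ ?_
  rw [mul_inv_rev, mul_assoc]
  exact mul_mem (inv_mem hd) (inv_minRep_mul_mem cs J w)

lemma length_minRep_mul {J : Set B} {w c : W} (hc : c ∈ parabolic cs J) :
    cs.length (minRep cs J w * c) = cs.length (minRep cs J w) + cs.length c := by
  obtain ⟨γ₀, hγ₀, rfl⟩ := exists_word_of_mem_parabolic cs hc
  obtain ⟨γ, hsub, hred, hprod⟩ := exists_isReduced_sublist cs γ₀
  rw [← hprod]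
  replace hγ₀ : ∀ i ∈ γ, i ∈ J := fun i hi => hγ₀ i (hsub.subset hi)
  clear hc hsub hprod
  obtain ⟨α, hα, hαw⟩ := cs.exists_isReduced (minRep cs J w)
  induction γ using List.reverseRecOn with
  | nil => simp
  | append_singleton γ i ih =>
    have hγred : cs.IsReduced γ := by simpa using hred.take γ.length
    have hγJ : ∀ j ∈ γ, j ∈ J := fun j hj => hγ₀ j (by simp [hj])
    have hiJ : i ∈ J := hγ₀ i (by simp)
    have hγs := hred.eq
    specialize ih hγred hγJ
    rw [cs.wordProd_append, cs.wordProd_singleton, List.length_append, List.length_singleton] at hγs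
    rw [cs.wordProd_append, cs.wordProd_singleton, hγs, ← mul_assoc]
    rcases cs.length_mul_simple (minRep cs J w * cs.wordProd γ) i with hl | hl
    · rw [hl, ih, hγred.eq, add_assoc]
    exfalso
    rw [hαw, ← cs.wordProd_append] at hl
    obtain ⟨j, hj, hjeq⟩ := exists_eraseIdx_of_length_mul_lt cs (cs.isReflection_simple i) (α ++ γ)
      (by omega)
    rw [cs.wordProd_append] at hjeq
    by_cases hjα : j < α.length
    · rw [List.eraseIdx_append_of_lt_length hjα, cs.wordProd_append] at hjeq
      have hd : cs.wordProd γ * cs.simple i * (cs.wordProd γ)⁻¹ ∈ parabolic cs J :=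
        mul_mem (mul_mem (wordProd_mem_parabolic cs hγJ)
          (Subgroup.subset_closure ⟨i, hiJ, rfl⟩)) (inv_mem (wordProd_mem_parabolic cs hγJ))
      have hmin := length_minRep_le cs (w := w) hd
      have e : minRep cs J w * (cs.wordProd γ * cs.simple i * (cs.wordProd γ)⁻¹) =
          cs.wordProd (α.eraseIdx j) := by
        rw [hαw, ← mul_assoc, ← mul_assoc, hjeq, mul_inv_cancel_right]
      rw [e, hαw, hα.eq] at hmin
      have := cs.length_wordProd_le (α.eraseIdx j)
      have := List.length_eraseIdx_add_one hjα
      omega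
    · rw [List.eraseIdx_append_of_length_le (by omega), cs.wordProd_append, mul_assoc,
        mul_right_inj] at hjeq
      have := cs.length_wordProd_le (γ.eraseIdx (j - α.length))
      have := List.length_eraseIdx_le γ (j - α.length)
      rw [← hjeq] at *
      omega

end Parabolic

/-- If `a ≤ c⁻¹ b`, then some `d ≤ c` can be cancelled from `a` so that `d a ≤ b`. -/
lemma exists_bruhatLE_length_sub {a b c : W} (h : bruhatLE cs a (c⁻¹ * b)) :
    ∃ d, bruhatLE cs d c ∧ cs.length (d * a) + cs.length d = cs.length a ∧
      bruhatLE cs (d * a) b := by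
  obtain ⟨ω, hω, hc⟩ := cs.exists_isReduced c⁻¹
  rw [← inv_inv c]
  rw [hc] at h ⊢
  clear hc
  induction ω generalizing a with
  | nil => exact ⟨1, by simpa using bruhatLE_refl cs 1, by simp, by simpa using h⟩
  | cons i ω ih =>
    have hup := length_lt_of_isReduced_cons cs hω
    have hup' : cs.length (cs.wordProd ω)⁻¹ <
        cs.length ((cs.wordProd ω)⁻¹ * cs.simple i) := by
      rwa [← cs.length_inv ((cs.wordProd ω)⁻¹ * cs.simple i), mul_inv_rev, inv_inv,
        cs.inv_simple, cs.length_inv]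
    rw [cs.wordProd_cons, mul_assoc] at h
    rw [cs.wordProd_cons, mul_inv_rev, cs.inv_simple]
    set z := cs.wordProd ω * b with hz
    rcases cs.length_simple_mul a i with ha | ha
    · have haz : bruhatLE cs a z := by
        simpa using (h.le_simple_mul cs i).2 (by omega)
      obtain ⟨d, hd, hlen, hle⟩ := ih haz (isReduced_of_cons cs hω)
      exact ⟨d, hd.trans cs (bruhatLE_mul_simple cs hup'), hlen, hle⟩
    · have haz : bruhatLE cs (cs.simple i * a) z := by
        simpa using (h.le_simple_mul cs i).1 (by omega)
      obtain ⟨d, hd, hlen, hle⟩ := ih haz (isReduced_of_cons cs hω)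
      refine ⟨d * cs.simple i, ?_, ?_, by rwa [mul_assoc]⟩
      · have := (hd.inv cs).simple_mul_le_simple_mul cs (i := i) (by simpa using hup)
        simpa using this.inv cs
      · have h₁ := cs.length_mul_simple d i
        have h₂ := cs.length_le_length_mul_add_left (d * cs.simple i) a
        rw [mul_assoc] at h₂ ⊢
        omega

/-- If `b₀ ≤ b`, then `c⁻¹ b₀` lies below some length-additive product `d⁻¹ b` with `d ≤ c`. -/
lemma exists_bruhatLE_length_add {b₀ b : W} (c : W) (h : bruhatLE cs b₀ b) :
    ∃ d, bruhatLE cs d c ∧ cs.length (d⁻¹ * b) = cs.length d + cs.length b ∧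
      bruhatLE cs (c⁻¹ * b₀) (d⁻¹ * b) := by
  obtain ⟨ω, hω, hc⟩ := cs.exists_isReduced c⁻¹
  rw [← inv_inv c, inv_inv c⁻¹]
  rw [hc]
  clear hc
  induction ω with
  | nil => exact ⟨1, by simpa using bruhatLE_refl cs 1, by simp, by simpa using h⟩
  | cons i ω ih =>
    have hup := length_lt_of_isReduced_cons cs hω
    have hup' : cs.length (cs.wordProd ω)⁻¹ <
        cs.length ((cs.wordProd ω)⁻¹ * cs.simple i) := by
      rwa [← cs.length_inv ((cs.wordProd ω)⁻¹ * cs.simple i), mul_inv_rev, inv_inv,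
        cs.inv_simple, cs.length_inv]
    obtain ⟨d, hd, hlen, hle⟩ := ih (isReduced_of_cons cs hω)
    rw [cs.wordProd_cons, mul_inv_rev, cs.inv_simple, mul_assoc]
    rcases cs.length_simple_mul (d⁻¹ * b) i with hl | hl
    · refine ⟨d * cs.simple i, ?_, ?_, ?_⟩
      · have := (hd.inv cs).simple_mul_le_simple_mul cs (i := i) (by simpa using hup)
        simpa using this.inv cs
      · have h₁ := cs.length_mul_simple d i
        have h₂ := cs.length_mul_le (cs.simple i * d⁻¹) b
        have h₃ := cs.length_inv (d * cs.simple i)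
        rw [mul_inv_rev, cs.inv_simple] at h₃ ⊢
        rw [mul_assoc] at h₂ ⊢
        omega
      · rw [mul_inv_rev, cs.inv_simple, mul_assoc]
        exact hle.simple_mul_le_simple_mul cs (by omega)
    · exact ⟨d, hd.trans cs (bruhatLE_mul_simple cs hup'), hlen,
        hle.simple_mul_le cs (by omega)⟩

/-- Let `v ≤^J w` and let `c` be a Bruhat-minimal element of the
(nonempty) set `{u ∈ W_J : v^J u ≤ w^J and w_J ≤ u⁻¹v_J}`. Then
`ℓ(c w_J) = ℓ(w_J) - ℓ(c)` and `ℓ(c⁻¹ v_J) = ℓ(c) + ℓ(v_J)`. -/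
theorem minimal_u_lengths (J : Set B) (v w c : W) (hvw : twistedLE cs J v w)
    (hcJ : c ∈ parabolic cs J)
    (hc₁ : bruhatLE cs (minRep cs J v * c) (minRep cs J w))
    (hc₂ : bruhatLE cs (parPart cs J w) (c⁻¹ * parPart cs J v))
    (hmin : ∀ x : W, x ∈ parabolic cs J →
      bruhatLE cs (minRep cs J v * x) (minRep cs J w) →
      bruhatLE cs (parPart cs J w) (x⁻¹ * parPart cs J v) →
      bruhatLE cs x c → x = c) :
    cs.length (c * parPart cs J w) + cs.length c = cs.length (parPart cs J w) ∧
    cs.length (c⁻¹ * parPart cs J v) = cs.length c + cs.length (parPart cs J v) := by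
  obtain ⟨d, hdc, hdlen, hdle⟩ := exists_bruhatLE_length_sub cs hc₂
  obtain ⟨e, hed, helen, hele⟩ := exists_bruhatLE_length_add cs d hdle
  rw [inv_mul_cancel_left] at hele
  have hec : bruhatLE cs e c := hed.trans cs hdc
  have hxe : bruhatLE cs (minRep cs J v * e) (minRep cs J w) :=
    (hec.mul_of_length_add cs (length_minRep_mul cs hcJ)).trans cs hc₁
  obtain rfl := hmin e (mem_parabolic_of_bruhatLE cs hec hcJ) hxe hele hec
  obtain rfl := hdc.antisymm cs hed
  exact ⟨hdlen, helen⟩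

end TwistedTP
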